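/- arXiv:2204.00516 — 2 statements merged into one kernel-verified Lean document; each statement's English description precedes it below -/
import Mathlib

section
/- For every element u ∈ L with (u,u) < 0, there exists an element w ∈ L with (w,w) = −(u,u) such that the composition ρ_u ∘ ρ_w of the reflections of L_ℚ maps the lattice L to itself, i.e., ρ_u ρ_w belongs to O(L). -/
noncomputable section

open LinearMap (BilinForm)

variable {V : Type*} [AddCommGroup V] [Module ℚ V]

/-- The group `O(B)` of isometries of a bilinear form `B`. -/
def isomGroup (B : BilinForm ℚ V) : Subgroup (V ≃ₗ[ℚ] V) where
  carrier := {g | ∀ x y, B (g x) (g y) = B x y}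
  one_mem' := fun _ _ => rfl
  mul_mem' := by
    intro a b ha hb x y
    calc B ((a * b) x) ((a * b) y) = B (a (b x)) (a (b y)) := rfl
      _ = B (b x) (b y) := ha _ _
      _ = B x y := hb _ _
  inv_mem' := by
    intro a ha x y
    calc B (a⁻¹ x) (a⁻¹ y) = B (a (a⁻¹ x)) (a (a⁻¹ y)) := (ha _ _).symm
      _ = B x y := by
          show B (a (a.symm x)) (a (a.symm y)) = B x y
          rw [a.apply_symm_apply, a.apply_symm_apply]

/-- `P` is a 3-dimensional positive-definite subspace for `B`. -/
def IsPosDefThree (B : BilinForm ℚ V) (P : Submodule ℚ V) : Prop :=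
  Module.finrank ℚ P = 3 ∧ ∀ x ∈ P, x ≠ 0 → 0 < B x x

/-- `g` preserves the orientation of the positive cone of `B`: for some 3-dimensional
positive-definite subspace `P`, the composition of the restriction of `g` to `P` with the
`B`-orthogonal projection back onto `P` has positive determinant. -/
def OrientPos (B : BilinForm ℚ V) (g : V ≃ₗ[ℚ] V) : Prop :=
  ∃ P : Submodule ℚ V, IsPosDefThree B P ∧
    ∃ π : V →ₗ[ℚ] V, (∀ x, π x ∈ P) ∧ (∀ x, ∀ p ∈ P, B (x - π x) p = 0) ∧
      ∃ q : ↥P →ₗ[ℚ] ↥P, (∀ x : ↥P, (q x : V) = π (g (x : V))) ∧ 0 < LinearMap.det q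

/-- The dual lattice `L* = {x : (x, L) ⊆ ℤ}` of a lattice `L`. -/
def dualLattice (B : BilinForm ℚ V) (L : Submodule ℤ V) : Submodule ℤ V where
  carrier := {x | ∀ y ∈ L, ∃ n : ℤ, B x y = (n : ℚ)}
  zero_mem' := by
    intro y _
    exact ⟨0, by simp⟩
  add_mem' := by
    intro a b ha hb y hy
    obtain ⟨m, hm⟩ := ha y hy
    obtain ⟨n, hn⟩ := hb y hy
    refine ⟨m + n, ?_⟩
    rw [map_add, LinearMap.add_apply, hm, hn]
    push_cast
    ring
  smul_mem' := by
    intro c x hx y hy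
    obtain ⟨n, hn⟩ := hx y hy
    refine ⟨c * n, ?_⟩
    have h1 : ((c : ℚ)) • x = c • x := Int.cast_smul_eq_zsmul ℚ c x
    rw [← h1, map_smul, LinearMap.smul_apply, hn, smul_eq_mul]
    push_cast
    ring

/-- `g` maps the lattice `L` bijectively onto itself. -/
def PreservesLattice (L : Submodule ℤ V) (g : V ≃ₗ[ℚ] V) : Prop :=
  (∀ x ∈ L, g x ∈ L) ∧ ∀ x ∈ L, g.symm x ∈ L

/-- `g` acts on the discriminant group `L*/L` as `+1` or as `-1`. -/
def ActsAsPMOne (B : BilinForm ℚ V) (L : Submodule ℤ V) (g : V ≃ₗ[ℚ] V) : Prop :=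
  (∀ x ∈ dualLattice B L, g x - x ∈ L) ∨ ∀ x ∈ dualLattice B L, g x + x ∈ L

/-- Membership in the subgroup `Γ ⊆ O⁺(Λ)` of isometries preserving the lattice and acting
on the discriminant group as `±1`. -/
def InGamma (B : BilinForm ℚ V) (L : Submodule ℤ V) (g : V ≃ₗ[ℚ] V) : Prop :=
  g ∈ isomGroup B ∧ PreservesLattice L g ∧ OrientPos B g ∧ ActsAsPMOne B L g

/-- The bilinear form of `Λ_ℚ = L_ℚ ⊕ ℚδ` with `(δ, δ) = -2d`. -/
def prodForm (B : BilinForm ℚ V) (d : ℤ) : BilinForm ℚ (V × ℚ) :=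
  LinearMap.mk₂ ℚ (fun p q => B p.1 q.1 - (2 * (d : ℚ)) * (p.2 * q.2))
    (fun p p' q => by
      simp only [Prod.fst_add, Prod.snd_add, map_add, LinearMap.add_apply]
      ring)
    (fun c p q => by
      simp only [Prod.smul_fst, Prod.smul_snd, map_smul, LinearMap.smul_apply, smul_eq_mul]
      ring)
    (fun p q q' => by
      simp only [Prod.fst_add, Prod.snd_add, map_add, LinearMap.add_apply]
      ring)
    (fun p c q => by
      simp only [Prod.smul_fst, Prod.smul_snd, map_smul, LinearMap.smul_apply, smul_eq_mul]
      ring)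

/-- The lattice `ℤ ⊆ ℚ`, i.e. the ℤ-span of `1`. -/
def intLat : Submodule ℤ ℚ := Submodule.span ℤ {(1 : ℚ)}

/-- Membership in the subgroup `O(L_ℚ) ⊆ O(Λ_ℚ)`: isometries of `Λ_ℚ = L_ℚ ⊕ ℚδ` preserving
`L_ℚ` and fixing `δ`, i.e. extensions of isometries of `L_ℚ` by the identity on `δ`. -/
def InOLQ (B : BilinForm ℚ V) (d : ℤ) (g : (V × ℚ) ≃ₗ[ℚ] (V × ℚ)) : Prop :=
  g ∈ isomGroup (prodForm B d) ∧ (∀ x : V, (g (x, 0)).2 = 0) ∧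
    g ((0 : V), (1 : ℚ)) = ((0 : V), (1 : ℚ))

/-- `B` has signature `(3, s)`: an orthogonal direct sum decomposition into a positive-definite
subspace of dimension `3` and a negative-definite subspace of dimension `s`. -/
def HasSignatureThree (B : BilinForm ℚ V) (s : ℕ) : Prop :=
  ∃ P N : Submodule ℚ V, IsCompl P N ∧ (∀ x ∈ P, ∀ y ∈ N, B x y = 0) ∧
    Module.finrank ℚ P = 3 ∧ Module.finrank ℚ N = s ∧
    (∀ x ∈ P, x ≠ 0 → 0 < B x x) ∧ ∀ x ∈ N, x ≠ 0 → B x x < 0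

/-- `L` contains a sublattice isometric to `U ⊕ U ⊕ U`, where `U` is the hyperbolic plane with
isotropic basis `e, f` and `(e, f) = -1`. -/
def ContainsU3 (B : BilinForm ℚ V) (L : Submodule ℤ V) : Prop :=
  ∃ e f : Fin 3 → V, (∀ i, e i ∈ L) ∧ (∀ i, f i ∈ L) ∧
    (∀ i j, B (e i) (e j) = 0) ∧ (∀ i j, B (f i) (f j) = 0) ∧
    ∀ i j, B (e i) (f j) = if i = j then -1 else 0

/-- `l` is a primitive element of the lattice `L`: `l ∈ L`, `l ≠ 0` and `L/ℤl` is
torsion-free. -/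
def IsPrimitiveIn (L : Submodule ℤ V) (l : V) : Prop :=
  l ∈ L ∧ l ≠ 0 ∧ ∀ y ∈ L, ∀ n : ℤ, n ≠ 0 →
    n • y ∈ Submodule.span ℤ ({l} : Set V) → y ∈ Submodule.span ℤ ({l} : Set V)

/-- The reflection `ρ_u(x) = x - (2(u,x)/(u,u))·u` (as a plain function). -/
def reflFun (B : BilinForm ℚ V) (u : V) (x : V) : V :=
  x - (2 * B u x / B u u) • u

/-- A minimal positive value of an integral bilinear form in two pairs of variables is attained
at a coprime first argument and divides all values sharing the same first argument. -/
theorem coprime_and_dvd_of_minimal_value {a b c d x₁ x₂ y₁ y₂ m : ℤ} (hm : 0 < m)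
    (hval : a * x₁ * y₁ + b * x₁ * y₂ + c * x₂ * y₁ + d * x₂ * y₂ = m)
    (hmin : ∀ s₁ s₂ t₁ t₂ : ℤ, 0 < a * s₁ * t₁ + b * s₁ * t₂ + c * s₂ * t₁ + d * s₂ * t₂ →
      m ≤ a * s₁ * t₁ + b * s₁ * t₂ + c * s₂ * t₁ + d * s₂ * t₂) :
    IsCoprime x₁ x₂ ∧
      ∀ t₁ t₂ : ℤ, m ∣ a * x₁ * t₁ + b * x₁ * t₂ + c * x₂ * t₁ + d * x₂ * t₂ := by
  constructor
  · rw [Int.isCoprime_iff_gcd_eq_one]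
    obtain ⟨z₁, hz₁⟩ : (Int.gcd x₁ x₂ : ℤ) ∣ x₁ := Int.gcd_dvd_left ..
    obtain ⟨z₂, hz₂⟩ : (Int.gcd x₁ x₂ : ℤ) ∣ x₂ := Int.gcd_dvd_right ..
    set g := Int.gcd x₁ x₂
    have hg : (0 : ℤ) ≤ g := Int.natCast_nonneg g
    have hfac : (g : ℤ) * (a * z₁ * y₁ + b * z₁ * y₂ + c * z₂ * y₁ + d * z₂ * y₂) = m := by
      rw [← hval, hz₁, hz₂]; ring
    have hpos : 0 < a * z₁ * y₁ + b * z₁ * y₂ + c * z₂ * y₁ + d * z₂ * y₂ :=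
      pos_of_mul_pos_right (hfac ▸ hm) hg
    have hle := hmin _ _ _ _ hpos
    have hg0 : (g : ℤ) ≠ 0 := by
      intro h
      rw [h, zero_mul] at hfac
      omega
    have : (g : ℤ) ≤ 1 := by nlinarith
    omega
  · intro t₁ t₂
    set k := a * x₁ * t₁ + b * x₁ * t₂ + c * x₂ * t₁ + d * x₂ * t₂ with hk
    have hrem : a * x₁ * (t₁ - k / m * y₁) + b * x₁ * (t₂ - k / m * y₂)
        + c * x₂ * (t₁ - k / m * y₁) + d * x₂ * (t₂ - k / m * y₂) = k % m := by
      rw [Int.emod_def]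
      linear_combination -hk - (k / m) * hval
    by_contra hdvd
    have hlt := Int.emod_lt_of_pos k hm
    have hpos := Int.emod_pos_of_not_dvd hdvd
    have hle := hmin x₁ x₂ (t₁ - k / m * y₁) (t₂ - k / m * y₂) (by rw [hrem]; omega)
    rw [hrem] at hle
    omega

/-- An integral `2 × 2` matrix can be diagonalized by left and right multiplication with
matrices of determinant `1`. -/
theorem exists_diagonalization_int_two (a b c d : ℤ) :
    ∃ x₁ x₂ z₁ z₂ y₁ y₂ w₁ w₂ : ℤ, x₁ * z₂ - x₂ * z₁ = 1 ∧ y₁ * w₂ - y₂ * w₁ = 1 ∧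
      a * x₁ * w₁ + b * x₁ * w₂ + c * x₂ * w₁ + d * x₂ * w₂ = 0 ∧
      a * z₁ * y₁ + b * z₁ * y₂ + c * z₂ * y₁ + d * z₂ * y₂ = 0 := by
  classical
  by_cases hne : ∃ n : ℕ, 0 < n ∧ ∃ s₁ s₂ t₁ t₂ : ℤ,
      a * s₁ * t₁ + b * s₁ * t₂ + c * s₂ * t₁ + d * s₂ * t₂ = n
  · obtain ⟨hm, x₁, x₂, y₁, y₂, hval⟩ := Nat.find_spec hne
    have hmin' := fun n => Nat.find_min' hne (m := n)
    set m := Nat.find hne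
    have hmpos : (0 : ℤ) < m := by exact_mod_cast hm
    have hmin : ∀ s₁ s₂ t₁ t₂ : ℤ,
        0 < a * s₁ * t₁ + b * s₁ * t₂ + c * s₂ * t₁ + d * s₂ * t₂ →
        (m : ℤ) ≤ a * s₁ * t₁ + b * s₁ * t₂ + c * s₂ * t₁ + d * s₂ * t₂ := by
      intro s₁ s₂ t₁ t₂ hpos
      have := hmin' (a * s₁ * t₁ + b * s₁ * t₂ + c * s₂ * t₁ + d * s₂ * t₂).toNat
        ⟨by omega, s₁, s₂, t₁, t₂, by omega⟩
      omega
    obtain ⟨⟨p, q, hx⟩, hdx⟩ := coprime_and_dvd_of_minimal_value hmpos hval hmin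
    obtain ⟨⟨r, s, hy⟩, hdy⟩ := coprime_and_dvd_of_minimal_value (a := a) (b := c) (c := b)
      (d := d) (x₁ := y₁) (x₂ := y₂) (y₁ := x₁) (y₂ := x₂) hmpos (by linear_combination hval)
      (fun s₁ s₂ t₁ t₂ hpos => by
        have := hmin t₁ t₂ s₁ s₂ (by linarith)
        linarith)
    obtain ⟨i, hi⟩ := hdx (-s) r
    obtain ⟨j, hj⟩ := hdy (-q) p
    refine ⟨x₁, x₂, -q - j * x₁, p - j * x₂, y₁, y₂, -s - i * y₁, r - i * y₂,
      ?_, ?_, ?_, ?_⟩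
    · linear_combination hx
    · linear_combination hy
    · linear_combination hi - i * hval
    · linear_combination hj - j * hval
  · have hzero : ∀ s₁ s₂ t₁ t₂ : ℤ,
        a * s₁ * t₁ + b * s₁ * t₂ + c * s₂ * t₁ + d * s₂ * t₂ ≤ 0 := by
      intro s₁ s₂ t₁ t₂
      by_contra! hpos
      exact hne ⟨_, by omega, s₁, s₂, t₁, t₂, (Int.toNat_of_nonneg hpos.le).symm⟩
    refine ⟨1, 0, 0, 1, 1, 0, 0, 1, by norm_num, by norm_num, ?_, ?_⟩
    · have h₁ := hzero 1 0 0 1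
      have h₂ := hzero (-1) 0 0 1
      linarith
    · have h₁ := hzero 0 1 1 0
      have h₂ := hzero 0 (-1) 1 0
      linarith

theorem intCast_smul_mem_lattice {L : Submodule ℤ V} (n : ℤ) {x : V} (hx : x ∈ L) :
    (n : ℚ) • x ∈ L := by
  rw [Int.cast_smul_eq_zsmul]
  exact L.smul_mem n hx

/-- In a lattice containing two orthogonal hyperbolic planes, every vector is orthogonal to
some hyperbolic plane. -/
theorem exists_orthogonal_hyperbolic_pair {B : BilinForm ℚ V} {L : Submodule ℤ V}
    (hsymm : ∀ x y, B x y = B y x) (hint : ∀ x ∈ L, ∀ y ∈ L, ∃ n : ℤ, B x y = (n : ℚ))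
    (hU3 : ContainsU3 B L) {u : V} (hu : u ∈ L) :
    ∃ x ∈ L, ∃ y ∈ L, B x x = 0 ∧ B y y = 0 ∧ B x y = 1 ∧ B u x = 0 ∧ B u y = 0 := by
  obtain ⟨e, f, he, hf, hee, hff, hef⟩ := hU3
  have hfe : ∀ i j, B (f i) (e j) = if j = i then -1 else 0 := fun i j => by
    rw [hsymm, hef]
  obtain ⟨a, ha⟩ := hint u hu _ (he 0)
  obtain ⟨b, hb⟩ := hint u hu _ (he 1)
  obtain ⟨c, hc⟩ := hint u hu _ (hf 1)
  obtain ⟨d, hd⟩ := hint u hu _ (hf 0)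
  obtain ⟨x₁, x₂, z₁, z₂, y₁, y₂, w₁, w₂, hx, hy, h₁, h₂⟩ :=
    exists_diagonalization_int_two a b (-c) d
  let T : ℤ → ℤ → ℤ → ℤ → V := fun p q r s =>
    ((p * r : ℤ) : ℚ) • e 0 + ((q * s : ℤ) : ℚ) • f 0 + ((p * s : ℤ) : ℚ) • e 1
      + ((-(q * r) : ℤ) : ℚ) • f 1
  have hT : ∀ p q r s, T p q r s ∈ L := fun p q r s =>
    add_mem (add_mem (add_mem (intCast_smul_mem_lattice _ (he 0))
      (intCast_smul_mem_lattice _ (hf 0))) (intCast_smul_mem_lattice _ (he 1)))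
      (intCast_smul_mem_lattice _ (hf 1))
  have hTT : ∀ p q r s p' q' r' s', B (T p q r s) (T p' q' r' s')
      = ((-((p * q' - q * p') * (r * s' - s * r')) : ℤ) : ℚ) := by
    intro p q r s p' q' r' s'
    simp [T, hee, hff, hef, hfe]
    ring
  have huT : ∀ p q r s, B u (T p q r s)
      = ((a * p * r + b * p * s + -c * q * r + d * q * s : ℤ) : ℚ) := by
    intro p q r s
    simp [T, ha, hb, hc, hd]
    ring
  refine ⟨T x₁ x₂ w₁ w₂, hT _ _ _ _, T z₁ z₂ y₁ y₂, hT _ _ _ _, ?_, ?_, ?_, ?_, ?_⟩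
  · rw [hTT]; norm_cast; ring
  · rw [hTT]; norm_cast; ring
  · rw [hTT]; norm_cast
    linear_combination hx + (x₁ * z₂ - x₂ * z₁) * hy
  · rw [huT, h₁, Int.cast_zero]
  · rw [huT, h₂, Int.cast_zero]

/-- In an even lattice containing two orthogonal hyperbolic planes, a vector pairing to `1` with
some lattice vector pairs to `1` with some isotropic lattice vector. -/
theorem exists_isotropic_pairing_one {B : BilinForm ℚ V} {L : Submodule ℤ V}
    (hsymm : ∀ x y, B x y = B y x) (hint : ∀ x ∈ L, ∀ y ∈ L, ∃ n : ℤ, B x y = (n : ℚ))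
    (heven : ∀ x ∈ L, ∃ n : ℤ, B x x = 2 * (n : ℚ)) (hU3 : ContainsU3 B L)
    {u v : V} (hu : u ∈ L) (hv : v ∈ L) (huv : B u v = 1) :
    ∃ f ∈ L, B f f = 0 ∧ B u f = 1 := by
  obtain ⟨x, hx, y, hy, hxx, hyy, hxy, hux, huy⟩ :=
    exists_orthogonal_hyperbolic_pair hsymm hint hU3 hu
  obtain ⟨a, ha⟩ := hint v hv x hx
  obtain ⟨b, hb⟩ := hint v hv y hy
  obtain ⟨k, hk⟩ := heven v hv
  have hyx : B y x = 1 := by rw [hsymm, hxy]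
  have hxv : B x v = a := by rw [hsymm, ha]
  have hyv : B y v = b := by rw [hsymm, hb]
  refine ⟨v + ((1 - b : ℤ) : ℚ) • x + ((-(k - a * b) - a : ℤ) : ℚ) • y, add_mem (add_mem hv
    (intCast_smul_mem_lattice _ hx)) (intCast_smul_mem_lattice _ hy), ?_, ?_⟩
  · simp [hk, ha, hb, hyx, hxv, hyv, hxx, hyy, hxy]
    ring
  · simp [huv, hux, huy]

/-- Every anisotropic vector of a unimodular lattice is an integral multiple of a lattice vector
which pairs to `1` with some lattice vector. -/
theorem exists_eq_smul_pairing_one {B : BilinForm ℚ V} {L : Submodule ℤ V}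
    (hint : ∀ x ∈ L, ∀ y ∈ L, ∃ n : ℤ, B x y = (n : ℚ)) (hunimod : dualLattice B L = L)
    {u : V} (hu : u ∈ L) (huu : B u u ≠ 0) :
    ∃ m : ℤ, m ≠ 0 ∧ ∃ u₀ ∈ L, u = (m : ℚ) • u₀ ∧ ∃ v ∈ L, B u₀ v = 1 := by
  let I : Ideal ℤ :=
    { carrier := {n | ∃ v ∈ L, B u v = n}
      zero_mem' := ⟨0, L.zero_mem, by simp⟩
      add_mem' := by
        rintro a b ⟨v, hv, hva⟩ ⟨w, hw, hwb⟩
        exact ⟨v + w, add_mem hv hw, by simp [hva, hwb]⟩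
      smul_mem' := by
        rintro c n ⟨v, hv, hvn⟩
        exact ⟨(c : ℚ) • v, intCast_smul_mem_lattice c hv, by simp [hvn]⟩ }
  obtain ⟨m, hm⟩ := (IsPrincipalIdealRing.principal I).principal
  have hdvd : ∀ n, n ∈ I → m ∣ n := fun n hn => by
    rw [hm] at hn
    exact Ideal.mem_span_singleton.mp hn
  obtain ⟨v, hv, huv⟩ : m ∈ I := by
    rw [hm]
    exact Ideal.mem_span_singleton_self m
  have hm0 : m ≠ 0 := by
    rintro rfl
    obtain ⟨n, hn⟩ := hint u hu u hu
    have hn0 : n = 0 := zero_dvd_iff.mp (hdvd n ⟨u, hu, hn⟩)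
    exact huu (by simp [hn, hn0])
  have hmQ : (m : ℚ) ≠ 0 := by exact_mod_cast hm0
  refine ⟨m, hm0, (m : ℚ)⁻¹ • u, ?_, (smul_inv_smul₀ hmQ u).symm, v, hv, ?_⟩
  · rw [← hunimod]
    intro y hy
    obtain ⟨n, hn⟩ := hint u hu y hy
    obtain ⟨k, rfl⟩ := hdvd n ⟨y, hy, hn⟩
    exact ⟨k, by simp [hn, hmQ]⟩
  · simp [huv, hmQ]

theorem reflFun_smul_left (B : BilinForm ℚ V) {c : ℚ} (hc : c ≠ 0) (u x : V) :
    reflFun B (c • u) x = reflFun B u x := by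
  simp only [reflFun, map_smul, LinearMap.smul_apply, smul_eq_mul, smul_smul]
  congr 2
  by_cases hu : B u u = 0
  · simp [hu]
  · field_simp

/-- For isotropic `f` with `(u, f) = 1` and `(u, u) = 2n`, the product in either order of the
reflections in `u` and `u - 2n f` is `-1` on the hyperbolic plane spanned by `u - n f` and `f`,
and the identity on its orthogonal complement. -/
theorem reflFun_reflFun_of_isotropic {B : BilinForm ℚ V} (hsymm : ∀ x y, B x y = B y x)
    {u f : V} {n : ℚ} (hn : n ≠ 0) (huu : B u u = 2 * n) (hff : B f f = 0) (huf : B u f = 1)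
    (x : V) :
    reflFun B u (reflFun B (u - (2 * n) • f) x)
        = x - (2 * B f x) • u - (2 * (B u x - 2 * n * B f x)) • f ∧
      reflFun B (u - (2 * n) • f) (reflFun B u x)
        = x - (2 * B f x) • u - (2 * (B u x - 2 * n * B f x)) • f := by
  have hfu : B f u = 1 := by rw [hsymm, huf]
  constructor <;>
  · simp only [reflFun, huu, map_sub, map_smul, LinearMap.sub_apply, LinearMap.smul_apply,
      smul_eq_mul, hff, huf, hfu]
    match_scalars <;> field_simp <;> ring

/-- For every `u ∈ L` with `(u,u) < 0`, there exists `w ∈ L` with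
`(w,w) = −(u,u)` such that `ρ_u ρ_w` maps the lattice `L` to itself, i.e.
`ρ_u ρ_w ∈ O(L)`. -/
theorem statement12
    {V : Type*} [AddCommGroup V] [Module ℚ V] [FiniteDimensional ℚ V]
    (B : BilinForm ℚ V) (L : Submodule ℤ V)
    (hsymm : ∀ x y, B x y = B y x)
    (hfull : Submodule.span ℚ (L : Set V) = ⊤)
    (hfg : L.FG)
    (hint : ∀ x ∈ L, ∀ y ∈ L, ∃ n : ℤ, B x y = (n : ℚ))
    (heven : ∀ x ∈ L, ∃ n : ℤ, B x x = 2 * (n : ℚ))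
    (hunimod : dualLattice B L = L)
    (sminus : ℕ) (hs : 3 ≤ sminus) (hsig : HasSignatureThree B sminus)
    (hU3 : ContainsU3 B L)
    (u : V) (hu : u ∈ L) (huu : B u u < 0) :
    ∃ w ∈ L, B w w = -(B u u) ∧
      (∀ x ∈ L, reflFun B u (reflFun B w x) ∈ L) ∧
      ∀ x ∈ L, reflFun B w (reflFun B u x) ∈ L := by
  obtain ⟨m, hm, u₀, hu₀, rfl, v, hv, huv⟩ :=
    exists_eq_smul_pairing_one hint hunimod hu huu.ne
  obtain ⟨f, hf, hff, huf⟩ :=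
    exists_isotropic_pairing_one hsymm hint heven hU3 hu₀ hv huv
  obtain ⟨n, hn⟩ := heven u₀ hu₀
  have hmQ : (m : ℚ) ≠ 0 := by exact_mod_cast hm
  have hn0 : (n : ℚ) ≠ 0 := by
    intro h
    simp [hn, h] at huu
  have hfu : B f u₀ = 1 := by rw [hsymm, huf]
  have hmem : ∀ x ∈ L,
      x - (2 * B f x) • u₀ - (2 * (B u₀ x - 2 * n * B f x)) • f ∈ L := by
    intro x hx
    obtain ⟨a, ha⟩ := hint f hf x hx
    obtain ⟨b, hb⟩ := hint u₀ hu₀ x hx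
    rw [ha, hb]
    exact_mod_cast sub_mem (sub_mem hx (intCast_smul_mem_lattice (2 * a) hu₀))
      (intCast_smul_mem_lattice (2 * (b - 2 * n * a)) hf)
  refine ⟨(m : ℚ) • (u₀ - (2 * (n : ℚ)) • f), intCast_smul_mem_lattice m (sub_mem hu₀ ?_),
    ?_, ?_, ?_⟩
  · exact_mod_cast intCast_smul_mem_lattice (2 * n) hf
  · simp [hn, hff, huf, hfu]
  · intro x hx
    rw [reflFun_smul_left B hmQ, reflFun_smul_left B hmQ,
      (reflFun_reflFun_of_isotropic hsymm hn0 hn hff huf x).1]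
    exact hmem x hx
  · intro x hx
    rw [reflFun_smul_left B hmQ, reflFun_smul_left B hmQ,
      (reflFun_reflFun_of_isotropic hsymm hn0 hn hff huf x).2]
    exact hmem x hx
end
end

section
/- Assume L = U ⊕ U ⊕ U and d ≥ 3. Every g ∈ Γ acts on the discriminant group Λ*/Λ (a cyclic group of order 2d) as multiplication by a uniquely determined sign ξ(g) ∈ {±1}, the map g ↦ det(g)·ξ(g) is a group homomorphism Γ → {±1}, and its kernel Γ₀ together with the image of O⁺(L) in Γ (each isometry of L being extended by the identity on δ) generate Γ. In particular, there is a reflection ρ_w ∈ O⁺(L) in a class w ∈ L with (w,w) = −2 on which the character det·ξ takes the value −1. -/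
noncomputable section

open LinearMap (BilinForm)

variable {V : Type*} [AddCommGroup V] [Module ℚ V]

section PositiveTriples

open Matrix

theorem Matrix.det_pos_of_dotProduct_mulVec_pos_fin_three (M : Matrix (Fin 3) (Fin 3) ℚ)
    (hM : ∀ x : Fin 3 → ℚ, x ≠ 0 → 0 < x ⬝ᵥ M *ᵥ x) : 0 < M.det := by
  have hx : ∀ a b c : ℚ, (a ≠ 0 ∨ b ≠ 0 ∨ c ≠ 0) →
      0 < M 0 0 * a ^ 2 + M 1 1 * b ^ 2 + M 2 2 * c ^ 2 + (M 0 1 + M 1 0) * (a * b)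
        + (M 0 2 + M 2 0) * (a * c) + (M 1 2 + M 2 1) * (b * c) := by
    intro a b c habc
    have h := hM ![a, b, c] (by
      intro h0
      have h1 := congrFun h0 0
      have h2 := congrFun h0 1
      have h3 := congrFun h0 2
      simp at h1 h2 h3
      tauto)
    simp only [dotProduct, mulVec, Fin.sum_univ_three] at h
    simp at h
    linarith
  rw [det_fin_three]
  generalize M 0 0 = m00 at *
  generalize M 0 1 = m01 at *
  generalize M 0 2 = m02 at *
  generalize M 1 0 = m10 at *
  generalize M 1 1 = m11 at *
  generalize M 1 2 = m12 at *
  generalize M 2 0 = m20 at *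
  generalize M 2 1 = m21 at *
  generalize M 2 2 = m22 at *
  have key : ∀ a b c k l m : ℚ,
      (∀ x y z : ℚ, (x ≠ 0 ∨ y ≠ 0 ∨ z ≠ 0) → 0 < a * x ^ 2 + b * y ^ 2 + c * z ^ 2
        + 2 * k * (x * y) + 2 * l * (x * z) + 2 * m * (y * z)) →
      0 < a * b * c + 2 * k * l * m - a * m ^ 2 - b * l ^ 2 - c * k ^ 2 := by
    intro a b c k l m h
    have h1 : 0 < a := by simpa using h 1 0 0 (by simp)
    have h2 : 0 < a * b - k ^ 2 := by
      have := h (-k) a 0 (Or.inr (Or.inl h1.ne'))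
      have h3 : 0 < a * (a * b - k ^ 2) := by linarith
      exact (mul_pos_iff_of_pos_left h1).1 h3
    have h3 := h (k * m - b * l) (k * l - a * m) (a * b - k ^ 2) (Or.inr (Or.inr h2.ne'))
    have h4 : 0 < (a * b - k ^ 2) *
      (a * b * c + 2 * k * l * m - a * m ^ 2 - b * l ^ 2 - c * k ^ 2) := by linarith
    exact (mul_pos_iff_of_pos_left h2).1 h4
  have hS := key m00 m11 m22 ((m01 + m10) / 2) ((m02 + m20) / 2) ((m12 + m21) / 2) (by
    intro x y z h
    have := hx x y z h
    linarith)
  have hK : 0 ≤ m00 * ((m12 - m21) / 2) ^ 2 + m11 * ((m02 - m20) / 2) ^ 2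
      + m22 * ((m01 - m10) / 2) ^ 2 - (m01 + m10) * ((m12 - m21) / 2 * ((m02 - m20) / 2))
      + (m02 + m20) * ((m12 - m21) / 2 * ((m01 - m10) / 2))
      - (m12 + m21) * ((m02 - m20) / 2 * ((m01 - m10) / 2)) := by
    by_cases h : (m12 - m21) / 2 ≠ 0 ∨ -((m02 - m20) / 2) ≠ 0 ∨ (m01 - m10) / 2 ≠ 0
    · have := hx _ _ _ h
      linarith
    · push Not at h
      obtain ⟨h1, h2, h3⟩ := h
      rw [neg_eq_zero] at h2
      simp [h1, h2, h3]
  linarith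

/-- The Gram matrix `(C(uᵢ, vⱼ))` of two triples of vectors. -/
def gramThree (C : BilinForm ℚ V) (u v : Fin 3 → V) : Matrix (Fin 3) (Fin 3) ℚ :=
  Matrix.of fun i j => C (u i) (v j)

/-- The triple `u` is linearly independent and spans a positive-definite subspace. -/
def IsPosTriple (C : BilinForm ℚ V) (u : Fin 3 → V) : Prop :=
  ∀ c : Fin 3 → ℚ, c ≠ 0 → 0 < C (∑ i, c i • u i) (∑ i, c i • u i)

theorem dotProduct_gramThree_mulVec (C : BilinForm ℚ V) (u v : Fin 3 → V) (x y : Fin 3 → ℚ) :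
    x ⬝ᵥ gramThree C u v *ᵥ y = C (∑ i, x i • u i) (∑ i, y i • v i) := by
  simp only [dotProduct, mulVec, gramThree, of_apply, Fin.sum_univ_three, map_add, map_smul,
    LinearMap.add_apply, LinearMap.smul_apply, smul_eq_mul]
  ring

theorem IsPosTriple.det_gramThree_self_pos {C : BilinForm ℚ V} {u : Fin 3 → V}
    (hu : IsPosTriple C u) : 0 < (gramThree C u u).det := by
  refine det_pos_of_dotProduct_mulVec_pos_fin_three _ fun x hx => ?_
  rw [dotProduct_gramThree_mulVec]
  exact hu x hx

theorem IsPosTriple.map {C : BilinForm ℚ V} {u : Fin 3 → V} (hu : IsPosTriple C u)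
    {g : V ≃ₗ[ℚ] V} (hg : g ∈ isomGroup C) : IsPosTriple C fun i => g (u i) := by
  intro c hc
  have h : ∑ i, c i • g (u i) = g (∑ i, c i • u i) := by simp only [map_sum, map_smul]
  rw [h, hg]
  exact hu c hc

theorem gramThree_map {C : BilinForm ℚ V} {g : V ≃ₗ[ℚ] V} (hg : g ∈ isomGroup C)
    (u v : Fin 3 → V) : gramThree C (fun i => g (u i)) (fun i => g (v i)) = gramThree C u v := by
  ext i j
  exact hg _ _

/-- A triple of pairwise orthogonal vectors of square `2` whose orthogonal complement is
negative semidefinite. -/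
structure IsMaximalPosFrame (C : BilinForm ℚ V) (p : Fin 3 → V) : Prop where
  apply_eq : ∀ i j, C (p i) (p j) = if i = j then 2 else 0
  nonpos : ∀ n, (∀ i, C n (p i) = 0) → C n n ≤ 0

theorem apply_sum_smul_frame {C : BilinForm ℚ V} {p : Fin 3 → V}
    (hp : IsMaximalPosFrame C p) (c : Fin 3 → ℚ) (j : Fin 3) :
    C (∑ i, c i • p i) (p j) = 2 * c j := by
  simp [map_sum, LinearMap.sum_apply, hp.apply_eq, mul_comm]

theorem IsMaximalPosFrame.isPosTriple {C : BilinForm ℚ V} {p : Fin 3 → V}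
    (hp : IsMaximalPosFrame C p) : IsPosTriple C p := by
  intro c hc
  have h : C (∑ i, c i • p i) (∑ i, c i • p i) = ∑ i, 2 * c i ^ 2 := by
    conv_lhs => rw [map_sum]
    refine Finset.sum_congr rfl fun i _ => ?_
    rw [map_smul, apply_sum_smul_frame hp, smul_eq_mul]
    ring
  rw [h]
  obtain ⟨i, hi⟩ := Function.ne_iff.1 hc
  exact Finset.sum_pos' (fun j _ => by positivity)
    ⟨i, Finset.mem_univ i, mul_pos two_pos (sq_pos_of_ne_zero hi)⟩

theorem IsPosTriple.det_gramThree_frame_ne_zero {C : BilinForm ℚ V} {u p : Fin 3 → V}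
    (hu : IsPosTriple C u) (hp : IsMaximalPosFrame C p) : (gramThree C u p).det ≠ 0 := by
  intro h0
  obtain ⟨c, hc, h⟩ := exists_vecMul_eq_zero_iff.2 h0
  refine (hu c hc).not_ge (hp.nonpos _ fun j => ?_)
  have := congrFun h j
  simpa [vecMul, dotProduct, gramThree, map_sum, LinearMap.sum_apply] using this

/-- The sign of the Gram determinant of two positive triples is the product of their orientations
relative to a maximal positive frame. -/
theorem IsPosTriple.det_gramThree_mul_pos {C : BilinForm ℚ V} (hC : ∀ x y, C x y = C y x)
    {u v p : Fin 3 → V} (hu : IsPosTriple C u) (hv : IsPosTriple C v)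
    (hp : IsMaximalPosFrame C p) :
    0 < (gramThree C u v).det * ((gramThree C u p).det * (gramThree C v p).det) := by
  set S := gramThree C u p with hS
  set T := gramThree C v p with hT
  have hSd : S.det ≠ 0 := hu.det_gramThree_frame_ne_zero hp
  have hTd : T.det ≠ 0 := hv.det_gramThree_frame_ne_zero hp
  have hpos : 0 < (S⁻¹ * gramThree C u v * T⁻¹ᵀ).det := by
    refine det_pos_of_dotProduct_mulVec_pos_fin_three _ fun x hx => ?_
    set y := x ᵥ* S⁻¹ with hy
    set z := x ᵥ* T⁻¹ with hz
    have hyS : y ᵥ* S = x := by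
      rw [hy, vecMul_vecMul, nonsing_inv_mul _ (isUnit_iff_ne_zero.2 hSd), vecMul_one]
    have hzT : z ᵥ* T = x := by
      rw [hz, vecMul_vecMul, nonsing_inv_mul _ (isUnit_iff_ne_zero.2 hTd), vecMul_one]
    have hy0 : y ≠ 0 := by
      rintro h
      rw [h, zero_vecMul] at hyS
      exact hx hyS.symm
    have hz0 : z ≠ 0 := by
      rintro h
      rw [h, zero_vecMul] at hzT
      exact hx hzT.symm
    have he : x ⬝ᵥ (S⁻¹ * gramThree C u v * T⁻¹ᵀ) *ᵥ x = y ⬝ᵥ gramThree C u v *ᵥ z := by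
      rw [← mulVec_mulVec, ← mulVec_mulVec, dotProduct_mulVec, mulVec_transpose]
    rw [he, dotProduct_gramThree_mulVec]
    have h1 := hu y hy0
    have h2 := hv z hz0
    have h3 := hp.nonpos (∑ i, y i • u i - ∑ i, z i • v i) fun j => by
      have e1 := congrFun hyS j
      have e2 := congrFun hzT j
      rw [map_sub, LinearMap.sub_apply, sub_eq_zero]
      have e3 : C (∑ i, y i • u i) (p j) = x j := by
        rw [← e1]
        simp [hS, vecMul, dotProduct, gramThree, map_sum, LinearMap.sum_apply]
      have e4 : C (∑ i, z i • v i) (p j) = x j := by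
        rw [← e2]
        simp [hT, vecMul, dotProduct, gramThree, map_sum, LinearMap.sum_apply]
      rw [e3, e4]
    have h4 := hC (∑ i, y i • u i) (∑ i, z i • v i)
    simp only [map_sub, LinearMap.sub_apply] at h3
    linarith
  rw [det_mul, det_mul, det_transpose, det_nonsing_inv, det_nonsing_inv] at hpos
  simp only [Ring.inverse_eq_inv'] at hpos
  have h2 : (gramThree C u v).det * (S.det * T.det)
      = (S.det⁻¹ * (gramThree C u v).det * T.det⁻¹) * (S.det ^ 2 * T.det ^ 2) := by
    field_simp
  rw [h2]
  exact mul_pos hpos (mul_pos (sq_pos_of_ne_zero hSd) (sq_pos_of_ne_zero hTd))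

/-- Whether an isometry preserves the orientation of a positive triple does not depend on the
triple. -/
theorem IsPosTriple.det_gramThree_frame_pos {C : BilinForm ℚ V} (hC : ∀ x y, C x y = C y x)
    {u p : Fin 3 → V} (hu : IsPosTriple C u) (hp : IsMaximalPosFrame C p)
    {g : V ≃ₗ[ℚ] V} (hg : g ∈ isomGroup C)
    (h : 0 < (gramThree C u fun i => g (u i)).det) :
    0 < (gramThree C p fun i => g (p i)).det := by
  have hgu := hu.map hg
  have hgp := hp.isPosTriple.map hg
  have h1 := hu.det_gramThree_mul_pos hC hgu hp
  have h2 := hgu.det_gramThree_mul_pos hC hgp hp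
  have h3 := hp.isPosTriple.det_gramThree_mul_pos hC hgp hp
  have h4 := hp.isPosTriple.det_gramThree_self_pos
  have h5 := hu.det_gramThree_frame_ne_zero hp
  rw [gramThree_map hg] at h2
  set a := (gramThree C u p).det
  set b := (gramThree C (fun i => g (u i)) p).det
  set c := (gramThree C (fun i => g (p i)) p).det
  have h6 : 0 < a * b := (mul_pos_iff_of_pos_left h).1 h1
  have h7 : 0 < c := (mul_pos_iff_of_pos_left h6).1 (by linarith)
  exact (mul_pos_iff_of_pos_right (mul_pos h4 h7)).1 h3

theorem OrientPos.exists_isPosTriple [FiniteDimensional ℚ V] {C : BilinForm ℚ V}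
    (hC : ∀ x y, C x y = C y x) {g : V ≃ₗ[ℚ] V} (hg : OrientPos C g) :
    ∃ u : Fin 3 → V, IsPosTriple C u ∧ 0 < (gramThree C u fun i => g (u i)).det := by
  obtain ⟨P, ⟨hP3, hPpos⟩, π, -, hπ, q, hq, hdet⟩ := hg
  let b := Module.finBasisOfFinrankEq ℚ P hP3
  have hu : IsPosTriple C fun i => (b i : V) := by
    intro c hc
    have he : ∑ i, c i • (b i : V) = ((∑ i, c i • b i : P) : V) := by simp
    rw [he]
    refine hPpos _ (Submodule.coe_mem _) fun h0 => hc ?_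
    have := Fintype.linearIndependent_iff.1 b.linearIndependent c (by exact_mod_cast h0)
    exact funext this
  refine ⟨_, hu, ?_⟩
  have hG : (gramThree C (fun i => (b i : V)) fun i => g (b i))
      = gramThree C (fun i => (b i : V)) (fun i => (b i : V)) * LinearMap.toMatrix b b q := by
    ext i j
    have h1 := hπ (g (b j)) (b i) (b i).2
    rw [map_sub, LinearMap.sub_apply, sub_eq_zero, ← hq, ← b.sum_repr (q (b j))] at h1
    rw [mul_apply]
    simp only [gramThree, of_apply, LinearMap.toMatrix_apply]
    rw [hC, h1]
    simp only [Submodule.coe_sum, Submodule.coe_smul, map_sum, map_smul, LinearMap.sum_apply,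
      LinearMap.smul_apply, smul_eq_mul]
    refine Finset.sum_congr rfl fun k _ => ?_
    rw [hC (b i), mul_comm]
  rw [hG, det_mul, LinearMap.det_toMatrix]
  exact mul_pos hu.det_gramThree_self_pos hdet

theorem IsMaximalPosFrame.orientPos {C : BilinForm ℚ V} (hC : ∀ x y, C x y = C y x)
    {p : Fin 3 → V} (hp : IsMaximalPosFrame C p) {g : V ≃ₗ[ℚ] V}
    (h : 0 < (gramThree C p fun i => g (p i)).det) : OrientPos C g := by
  have hli : LinearIndependent ℚ p := by
    rw [Fintype.linearIndependent_iff]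
    intro c hc i
    have := apply_sum_smul_frame hp c i
    rw [hc, map_zero, LinearMap.zero_apply] at this
    linarith
  let b := Module.Basis.span hli
  have hb : ∀ i, (b i : V) = p i := fun i => by
    simp only [b, Module.Basis.span_apply]
  let P := Submodule.span ℚ (Set.range p)
  let π : V →ₗ[ℚ] V := ∑ i, (LinearMap.toSpanSingleton ℚ V (p i)).comp ((1 / 2 : ℚ) • C (p i))
  have hπa : ∀ x, π x = ∑ i, (C (p i) x / 2) • p i := by
    intro x
    simp only [π, LinearMap.sum_apply, LinearMap.comp_apply, LinearMap.toSpanSingleton_apply,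
      LinearMap.smul_apply, smul_eq_mul]
    refine Finset.sum_congr rfl fun i _ => ?_
    congr 1
    ring
  have hπP : ∀ x, π x ∈ P := fun x => by
    rw [hπa]
    exact Submodule.sum_mem _ fun i _ =>
      Submodule.smul_mem _ _ (Submodule.subset_span (Set.mem_range_self i))
  refine ⟨P, ⟨?_, ?_⟩, π, hπP, ?_, ?_⟩
  · have := finrank_span_eq_card hli
    simpa using this
  · intro x hx hx0
    obtain ⟨c, rfl⟩ := (Submodule.mem_span_range_iff_exists_fun ℚ).1 hx
    refine hp.isPosTriple c ?_
    rintro rfl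
    simp at hx0
  · intro x y hy
    induction hy using Submodule.span_induction with
    | mem y hy =>
      obtain ⟨i, rfl⟩ := hy
      rw [map_sub, LinearMap.sub_apply, hπa, apply_sum_smul_frame hp, hC x]
      ring
    | zero => simp
    | add y z _ _ hy hz => rw [map_add, hy, hz, add_zero]
    | smul c y _ hy => rw [map_smul, hy, smul_zero]
  · refine ⟨(π.comp (g : V →ₗ[ℚ] V)).restrict (p := P) (q := P) fun x _ => hπP _, fun x => rfl, ?_⟩
    rw [← LinearMap.det_toMatrix b]
    have hM : LinearMap.toMatrix b b
        ((π.comp (g : V →ₗ[ℚ] V)).restrict (p := P) (q := P) fun x _ => hπP _)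
        = (1 / 2 : ℚ) • gramThree C p fun i => g (p i) := by
      ext i j
      rw [LinearMap.toMatrix_apply]
      have he : ((π.comp (g : V →ₗ[ℚ] V)).restrict (p := P) (q := P) fun x _ => hπP _) (b j)
          = ∑ i, (C (p i) (g (p j)) / 2) • b i := by
        apply Subtype.ext
        rw [LinearMap.coe_restrict_apply, LinearMap.comp_apply, hπa, hb]
        simp [hb]
      rw [he, b.repr_sum_self]
      simp [gramThree]
      ring
    rw [hM, det_smul]
    positivity

end PositiveTriples

theorem mem_intLat {q : ℚ} : q ∈ intLat ↔ ∃ n : ℤ, q = n := by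
  simp [intLat, Submodule.mem_span_singleton, eq_comm]

theorem prodForm_apply (B : BilinForm ℚ V) (d : ℤ) (p q : V × ℚ) :
    prodForm B d p q = B p.1 q.1 - 2 * (d : ℚ) * (p.2 * q.2) := rfl

theorem prodForm_comm {B : BilinForm ℚ V} (hB : ∀ x y, B x y = B y x) (d : ℤ) (p q : V × ℚ) :
    prodForm B d p q = prodForm B d q p := by
  rw [prodForm_apply, prodForm_apply, hB, mul_comm p.2]

theorem IsMaximalPosFrame.prod {B : BilinForm ℚ V} {p : Fin 3 → V} (hp : IsMaximalPosFrame B p)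
    {d : ℤ} (hd : 0 ≤ d) : IsMaximalPosFrame (prodForm B d) fun i => (p i, (0 : ℚ)) where
  apply_eq i j := by simp [prodForm_apply, hp.apply_eq]
  nonpos n hn := by
    have h1 : B n.1 n.1 ≤ 0 := hp.nonpos n.1 fun i => by simpa [prodForm_apply] using hn i
    have h2 : (0 : ℚ) ≤ 2 * (d : ℚ) * (n.2 * n.2) :=
      mul_nonneg (mul_nonneg zero_le_two (by exact_mod_cast hd)) (mul_self_nonneg _)
    rw [prodForm_apply]
    linarith

theorem mem_dualLattice_prodForm {B : BilinForm ℚ V} {L : Submodule ℤ V}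
    (hL : dualLattice B L = L) {d : ℤ} {x : V × ℚ} :
    x ∈ dualLattice (prodForm B d) (L.prod intLat) ↔
      x.1 ∈ L ∧ ∃ n : ℤ, 2 * (d : ℚ) * x.2 = n := by
  constructor
  · intro hx
    constructor
    · rw [← hL]
      intro y hy
      obtain ⟨n, hn⟩ := hx (y, 0) ⟨hy, zero_mem _⟩
      exact ⟨n, by simpa [prodForm_apply] using hn⟩
    · obtain ⟨n, hn⟩ := hx (0, 1) ⟨zero_mem _, mem_intLat.2 ⟨1, by simp⟩⟩
      refine ⟨-n, ?_⟩
      simp [prodForm_apply] at hn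
      push_cast
      linarith
  · rintro ⟨h1, n, hn⟩ y ⟨hy1, hy2⟩
    obtain ⟨m, hm⟩ := mem_intLat.1 hy2
    rw [← hL] at h1
    obtain ⟨k, hk⟩ := h1 y.1 hy1
    refine ⟨k - n * m, ?_⟩
    rw [prodForm_apply, hk, hm, ← mul_assoc, hn]
    push_cast
    ring

theorem discriminant_generator_mem {B : BilinForm ℚ V} {L : Submodule ℤ V}
    (hL : dualLattice B L = L) {d : ℤ} (hd : 0 < d) :
    ((0, 1 / (2 * (d : ℚ))) : V × ℚ) ∈ dualLattice (prodForm B d) (L.prod intLat) := by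
  have : (d : ℚ) ≠ 0 := by exact_mod_cast hd.ne'
  exact (mem_dualLattice_prodForm hL).2 ⟨zero_mem _, 1, by push_cast; field_simp⟩

theorem zsmul_discriminant_generator_mem_iff {W : Type*} [AddCommGroup W] (L : Submodule ℤ W)
    {d : ℤ} (hd : 0 < d) {m : ℤ} :
    m • ((0, 1 / (2 * (d : ℚ))) : W × ℚ) ∈ L.prod intLat ↔ 2 * d ∣ m := by
  have hd' : (d : ℚ) ≠ 0 := by exact_mod_cast hd.ne'
  rw [Submodule.mem_prod, mem_intLat]
  simp only [Prod.smul_fst, smul_zero, zero_mem, true_and, Prod.smul_snd, zsmul_eq_mul]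
  refine exists_congr fun n => ?_
  rw [mul_one_div, div_eq_iff (by positivity)]
  rw [mul_comm (2 * d) n]
  exact_mod_cast Iff.rfl

/-- The sign by which an isometry acts on the discriminant group is unique. -/
theorem discriminant_sign_unique {B : BilinForm ℚ V} {L : Submodule ℤ V}
    (hL : dualLattice B L = L) {d : ℤ} (hd : 1 < d) {g : (V × ℚ) ≃ₗ[ℚ] (V × ℚ)} {ε η : ℤ}
    (hε : ε = 1 ∨ ε = -1) (hη : η = 1 ∨ η = -1)
    (hgε : ∀ x ∈ dualLattice (prodForm B d) (L.prod intLat), g x - (ε : ℚ) • x ∈ L.prod intLat)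
    (hgη : ∀ x ∈ dualLattice (prodForm B d) (L.prod intLat), g x - (η : ℚ) • x ∈ L.prod intLat) :
    ε = η := by
  have hx := discriminant_generator_mem hL (zero_lt_one.trans hd)
  have h := sub_mem (hgε _ hx) (hgη _ hx)
  rw [sub_sub_sub_cancel_left, ← sub_smul, ← Int.cast_sub, Int.cast_smul_eq_zsmul,
    zsmul_discriminant_generator_mem_iff L (zero_lt_one.trans hd)] at h
  rcases hε with rfl | rfl <;> rcases hη with rfl | rfl
  · rfl
  · have := Int.le_of_dvd (by norm_num) ((dvd_neg).2 h)
    omega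
  · have := Int.le_of_dvd (by norm_num) h
    omega
  · rfl

theorem ActsAsPMOne.exists_sign {B : BilinForm ℚ V} {L : Submodule ℤ V} {g : V ≃ₗ[ℚ] V}
    (h : ActsAsPMOne B L g) :
    ∃ ε : ℤ, (ε = 1 ∨ ε = -1) ∧ ∀ x ∈ dualLattice B L, g x - (ε : ℚ) • x ∈ L := by
  rcases h with h | h
  · exact ⟨1, Or.inl rfl, fun x hx => by simpa using h x hx⟩
  · exact ⟨-1, Or.inr rfl, fun x hx => by simpa using h x hx⟩

theorem actsAsPMOne_of_sign {B : BilinForm ℚ V} {L : Submodule ℤ V} {g : V ≃ₗ[ℚ] V} {ε : ℤ}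
    (hε : ε = 1 ∨ ε = -1) (h : ∀ x ∈ dualLattice B L, g x - (ε : ℚ) • x ∈ L) :
    ActsAsPMOne B L g := by
  rcases hε with rfl | rfl
  · exact Or.inl fun x hx => by simpa using h x hx
  · exact Or.inr fun x hx => by simpa using h x hx

theorem mul_sub_smul_mem {B : BilinForm ℚ V} {L : Submodule ℤ V} {g₁ g₂ : V ≃ₗ[ℚ] V}
    (hg₁ : ∀ x ∈ L, g₁ x ∈ L) {ε₁ ε₂ : ℤ}
    (h₁ : ∀ x ∈ dualLattice B L, g₁ x - (ε₁ : ℚ) • x ∈ L)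
    (h₂ : ∀ x ∈ dualLattice B L, g₂ x - (ε₂ : ℚ) • x ∈ L) :
    ∀ x ∈ dualLattice B L, (g₁ * g₂) x - ((ε₁ * ε₂ : ℤ) : ℚ) • x ∈ L := by
  intro x hx
  have h3 : (ε₂ : ℚ) • (g₁ x - (ε₁ : ℚ) • x) ∈ L := by
    rw [Int.cast_smul_eq_zsmul]
    exact L.smul_mem _ (h₁ x hx)
  have h4 := add_mem (hg₁ _ (h₂ x hx)) h3
  have he : (g₁ * g₂) x - ((ε₁ * ε₂ : ℤ) : ℚ) • x
      = g₁ (g₂ x - (ε₂ : ℚ) • x) + (ε₂ : ℚ) • (g₁ x - (ε₁ : ℚ) • x) := by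
    rw [LinearEquiv.mul_apply, map_sub, map_smul, smul_sub, smul_smul, Int.cast_mul,
      mul_comm (ε₂ : ℚ)]
    abel
  rwa [he]

theorem PreservesLattice.mul {L : Submodule ℤ V} {g₁ g₂ : V ≃ₗ[ℚ] V}
    (h₁ : PreservesLattice L g₁) (h₂ : PreservesLattice L g₂) : PreservesLattice L (g₁ * g₂) :=
  ⟨fun x hx => h₁.1 _ (h₂.1 x hx), fun x hx => h₂.2 _ (h₁.2 x hx)⟩

theorem det_sq_eq_one_of_mem_isomGroup [FiniteDimensional ℚ V] {C : BilinForm ℚ V}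
    (hC : ∀ x y, C x y = C y x) (hnd : ∀ x, (∀ y, C x y = 0) → x = 0) {g : V ≃ₗ[ℚ] V}
    (hg : g ∈ isomGroup C) : LinearMap.det (g : V →ₗ[ℚ] V) ^ 2 = 1 := by
  let b := Module.finBasis ℚ V
  have hM : (LinearMap.BilinForm.toMatrix b C).det ≠ 0 := by
    rw [← LinearMap.BilinForm.nondegenerate_iff_det_ne_zero]
    exact ⟨hnd, fun y hy => hnd y fun x => by rw [hC, hy]⟩
  have hcomp : C.comp (g : V →ₗ[ℚ] V) (g : V →ₗ[ℚ] V) = C := by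
    ext x y
    exact hg x y
  have h := congrArg Matrix.det
    (LinearMap.BilinForm.toMatrix_comp b b C (g : V →ₗ[ℚ] V) (g : V →ₗ[ℚ] V))
  rw [hcomp, Matrix.det_mul, Matrix.det_mul, Matrix.det_transpose, LinearMap.det_toMatrix] at h
  apply mul_right_cancel₀ hM
  linear_combination -h

theorem prodForm_separating {B : BilinForm ℚ V} (hB : ∀ x, (∀ y, B x y = 0) → x = 0) {d : ℤ}
    (hd : d ≠ 0) (x : V × ℚ) (hx : ∀ y, prodForm B d x y = 0) : x = 0 := by
  refine Prod.ext (hB _ fun y => by simpa [prodForm_apply] using hx (y, 0)) ?_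
  simpa [prodForm_apply, hd] using hx (0, 1)

section HyperbolicBasis

variable {B : BilinForm ℚ V} {L : Submodule ℤ V} {e f : Fin 3 → V}

/-- `L` is the orthogonal sum of three hyperbolic planes with isotropic bases `eᵢ, fᵢ`,
`(eᵢ, fᵢ) = -1`, and spans the ambient space. -/
structure IsHyperbolicBasis (B : BilinForm ℚ V) (L : Submodule ℤ V) (e f : Fin 3 → V) :
    Prop where
  symm : ∀ x y, B x y = B y x
  left_left : ∀ i j, B (e i) (e j) = 0
  right_right : ∀ i j, B (f i) (f j) = 0
  left_right : ∀ i j, B (e i) (f j) = if i = j then -1 else 0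
  lattice_eq : L = Submodule.span ℤ (Set.range e ∪ Set.range f)
  span_eq_top : Submodule.span ℚ (L : Set V) = ⊤

namespace IsHyperbolicBasis

theorem left_mem (h : IsHyperbolicBasis B L e f) (i : Fin 3) : e i ∈ L := by
  rw [h.lattice_eq]
  exact Submodule.subset_span (Or.inl ⟨i, rfl⟩)

theorem right_mem (h : IsHyperbolicBasis B L e f) (i : Fin 3) : f i ∈ L := by
  rw [h.lattice_eq]
  exact Submodule.subset_span (Or.inr ⟨i, rfl⟩)

theorem right_left (h : IsHyperbolicBasis B L e f) (i j : Fin 3) :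
    B (f i) (e j) = if i = j then -1 else 0 := by
  rw [h.symm, h.left_right]
  simp only [eq_comm]

theorem eq_sum (h : IsHyperbolicBasis B L e f) (v : V) :
    v = -∑ i, (B v (f i) • e i + B v (e i) • f i) := by
  have hv : v ∈ Submodule.span ℚ (L : Set V) := h.span_eq_top ▸ Submodule.mem_top
  induction hv using Submodule.span_induction with
  | mem x hx =>
    rw [SetLike.mem_coe, h.lattice_eq] at hx
    induction hx using Submodule.span_induction with
    | mem y hy =>
      rcases hy with ⟨k, rfl⟩ | ⟨k, rfl⟩
      · simp [h.left_right, h.left_left, ite_smul]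
      · simp [h.right_left, h.right_right, ite_smul]
    | zero => simp
    | add x y _ _ hx hy =>
      conv_lhs => rw [hx, hy]
      simp only [map_add, LinearMap.add_apply, add_smul, Finset.sum_add_distrib]
      abel
    | smul c y _ hy =>
      conv_lhs => rw [hy]
      simp only [map_zsmul, LinearMap.smul_apply, smul_neg, Finset.smul_sum, smul_add, smul_assoc]
  | zero => simp
  | add x y _ _ hx hy =>
    conv_lhs => rw [hx, hy]
    simp only [map_add, LinearMap.add_apply, add_smul, Finset.sum_add_distrib]
    abel
  | smul c y _ hy =>
    conv_lhs => rw [hy]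
    simp only [map_smul, LinearMap.smul_apply, smul_neg, Finset.smul_sum, smul_add, smul_assoc]

theorem separating (h : IsHyperbolicBasis B L e f) (x : V) (hx : ∀ y, B x y = 0) : x = 0 := by
  rw [h.eq_sum x]
  simp [hx]

theorem mem_of_integral (h : IsHyperbolicBasis B L e f) {v : V}
    (he : ∀ i, ∃ n : ℤ, B v (e i) = n) (hf : ∀ i, ∃ n : ℤ, B v (f i) = n) : v ∈ L := by
  rw [h.eq_sum v]
  refine neg_mem (sum_mem fun i _ => add_mem ?_ ?_)
  · obtain ⟨n, hn⟩ := hf i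
    rw [hn, Int.cast_smul_eq_zsmul]
    exact L.smul_mem _ (h.left_mem i)
  · obtain ⟨n, hn⟩ := he i
    rw [hn, Int.cast_smul_eq_zsmul]
    exact L.smul_mem _ (h.right_mem i)

theorem mem_dualLattice_of_integral (h : IsHyperbolicBasis B L e f) {v : V}
    (he : ∀ i, ∃ n : ℤ, B v (e i) = n) (hf : ∀ i, ∃ n : ℤ, B v (f i) = n) :
    v ∈ dualLattice B L := by
  intro y hy
  rw [h.lattice_eq] at hy
  induction hy using Submodule.span_induction with
  | mem y hy =>
    rcases hy with ⟨k, rfl⟩ | ⟨k, rfl⟩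
    exacts [he k, hf k]
  | zero => exact ⟨0, by simp⟩
  | add x y _ _ hx hy =>
    obtain ⟨m, hm⟩ := hx
    obtain ⟨n, hn⟩ := hy
    exact ⟨m + n, by rw [map_add, hm, hn, Int.cast_add]⟩
  | smul c y _ hy =>
    obtain ⟨n, hn⟩ := hy
    exact ⟨c * n, by rw [map_zsmul, hn, zsmul_eq_mul, Int.cast_mul]⟩

theorem dualLattice_eq (h : IsHyperbolicBasis B L e f) : dualLattice B L = L := by
  refine le_antisymm
    (fun v hv => h.mem_of_integral (fun i => hv _ (h.left_mem i)) fun i => hv _ (h.right_mem i)) ?_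
  conv_lhs => rw [h.lattice_eq]
  rw [Submodule.span_le]
  rintro _ (⟨k, rfl⟩ | ⟨k, rfl⟩)
  · refine h.mem_dualLattice_of_integral (fun i => ⟨0, by simp [h.left_left]⟩) fun i =>
      ⟨if k = i then -1 else 0, by rw [h.left_right]; split_ifs <;> simp⟩
  · refine h.mem_dualLattice_of_integral
      (fun i => ⟨if k = i then -1 else 0, by rw [h.right_left]; split_ifs <;> simp⟩) fun i =>
      ⟨0, by simp [h.right_right]⟩

theorem isMaximalPosFrame (h : IsHyperbolicBasis B L e f) :
    IsMaximalPosFrame B fun i => e i - f i where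
  apply_eq i j := by
    simp only [map_sub, LinearMap.sub_apply, h.left_left, h.left_right, h.right_left,
      h.right_right]
    split_ifs <;> norm_num
  nonpos n hn := by
    have h1 : ∀ i, B n (f i) = B n (e i) := fun i => by
      have := hn i
      rw [map_sub] at this
      linarith
    have h2 : B n n = -∑ i, (B n (f i) * B n (e i) + B n (e i) * B n (f i)) := by
      conv_lhs =>
        enter [2]
        rw [h.eq_sum n]
      simp [map_sum]
    rw [h2, neg_nonpos]
    exact Finset.sum_nonneg fun i _ => by
      rw [h1]
      exact add_nonneg (mul_self_nonneg _) (mul_self_nonneg _)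

end IsHyperbolicBasis

end HyperbolicBasis

/-- The reflection in a vector `w` with `(w, w) = -2`. -/
def negTwoReflection (B : BilinForm ℚ V) (w : V) (hw : B w w = -2) : V ≃ₗ[ℚ] V :=
  Module.reflection (x := w) (f := -B w) (by rw [LinearMap.neg_apply, hw, neg_neg])

section NegTwoReflection

variable {B : BilinForm ℚ V} {w : V} (hw : B w w = -2)

theorem negTwoReflection_apply (x : V) : negTwoReflection B w hw x = x + B w x • w := by
  simp [negTwoReflection, Module.reflection_apply]

theorem negTwoReflection_mem_isomGroup (hB : ∀ x y, B x y = B y x) :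
    negTwoReflection B w hw ∈ isomGroup B := by
  intro x y
  simp only [negTwoReflection_apply, map_add, map_smul, LinearMap.add_apply,
    LinearMap.smul_apply, smul_eq_mul, hw]
  rw [hB x w]
  ring

theorem negTwoReflection_preservesLattice {L : Submodule ℤ V} (hL : dualLattice B L = L)
    (hwL : w ∈ L) : PreservesLattice L (negTwoReflection B w hw) := by
  have h : ∀ x ∈ L, negTwoReflection B w hw x ∈ L := by
    intro x hx
    have hw' := hwL
    rw [← hL] at hw'
    obtain ⟨n, hn⟩ := hw' x hx
    rw [negTwoReflection_apply, hn, Int.cast_smul_eq_zsmul]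
    exact add_mem hx (L.smul_mem _ hwL)
  refine ⟨h, fun x hx => ?_⟩
  have := h x hx
  rwa [negTwoReflection, Module.reflection_symm]

theorem det_negTwoReflection [FiniteDimensional ℚ V] :
    LinearMap.det (negTwoReflection B w hw : V →ₗ[ℚ] V) = -1 := by
  have h : (negTwoReflection B w hw : V →ₗ[ℚ] V) = LinearMap.transvection (B w) w := by
    ext x
    simp [negTwoReflection_apply, LinearMap.transvection.apply]
  rw [h, LinearMap.transvection.det, hw]
  norm_num

end NegTwoReflection

/-- The extension of an automorphism of `V` to `V × ℚ` by the identity on `ℚ`. -/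
def extendById (g : V ≃ₗ[ℚ] V) : (V × ℚ) ≃ₗ[ℚ] (V × ℚ) := g.prodCongr (LinearEquiv.refl ℚ ℚ)

theorem extendById_apply (g : V ≃ₗ[ℚ] V) (p : V × ℚ) : extendById g p = (g p.1, p.2) := rfl

theorem extendById_mem_isomGroup {B : BilinForm ℚ V} {g : V ≃ₗ[ℚ] V} (hg : g ∈ isomGroup B)
    (d : ℤ) : extendById g ∈ isomGroup (prodForm B d) := by
  intro x y
  simp only [extendById_apply, prodForm_apply]
  rw [hg]

theorem PreservesLattice.extendById {L : Submodule ℤ V} {g : V ≃ₗ[ℚ] V}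
    (hg : PreservesLattice L g) : PreservesLattice (L.prod intLat) (extendById g) :=
  ⟨fun _ hx => ⟨hg.1 _ hx.1, hx.2⟩, fun _ hx => ⟨hg.2 _ hx.1, hx.2⟩⟩

theorem extendById_sub_mem {B : BilinForm ℚ V} {L : Submodule ℤ V}
    (hL : dualLattice B L = L) {g : V ≃ₗ[ℚ] V} (hg : PreservesLattice L g) {d : ℤ} :
    ∀ x ∈ dualLattice (prodForm B d) (L.prod intLat),
      extendById g x - ((1 : ℤ) : ℚ) • x ∈ L.prod intLat := by
  intro x hx
  have h := ((mem_dualLattice_prodForm hL).1 hx).1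
  refine ⟨?_, ?_⟩
  · simpa [extendById_apply] using sub_mem (hg.1 _ h) h
  · simp [extendById_apply]

theorem det_extendById [FiniteDimensional ℚ V] (g : V ≃ₗ[ℚ] V) :
    LinearMap.det (extendById g : (V × ℚ) →ₗ[ℚ] (V × ℚ)) = LinearMap.det (g : V →ₗ[ℚ] V) := by
  have h : (extendById g : (V × ℚ) →ₗ[ℚ] (V × ℚ)) = (g : V →ₗ[ℚ] V).prodMap LinearMap.id := by
    ext <;> rfl
  rw [h, LinearMap.det_prodMap, LinearMap.det_id, mul_one]

/-- Composing with a lattice isometry of `V` that fixes a maximal positive frame preserves `Γ`. -/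
theorem InGamma.extendById_mul [FiniteDimensional ℚ V] {B : BilinForm ℚ V} {L : Submodule ℤ V}
    (hB : ∀ x y, B x y = B y x) (hL : dualLattice B L = L) {d : ℤ} (hd : 0 ≤ d)
    {p : Fin 3 → V} (hp : IsMaximalPosFrame B p) {h : V ≃ₗ[ℚ] V} (hh : h ∈ isomGroup B)
    (hhL : PreservesLattice L h) (hhp : ∀ i, h (p i) = p i) {g : (V × ℚ) ≃ₗ[ℚ] (V × ℚ)}
    (hg : InGamma (prodForm B d) (L.prod intLat) g) :
    InGamma (prodForm B d) (L.prod intLat) (extendById h * g) := by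
  obtain ⟨hgi, hgL, hgo, hga⟩ := hg
  have hext := extendById_mem_isomGroup hh d
  have hC := prodForm_comm hB d
  have hfr := hp.prod hd
  obtain ⟨ε, hε, hgε⟩ := hga.exists_sign
  refine ⟨mul_mem hext hgi, hhL.extendById.mul hgL, ?_, actsAsPMOne_of_sign (ε := 1 * ε)
    (by simpa using hε) (mul_sub_smul_mem hhL.extendById.1 (extendById_sub_mem hL hhL) hgε)⟩
  refine hfr.orientPos hC ?_
  obtain ⟨u, hu, hpos⟩ := hgo.exists_isPosTriple hC
  convert hu.det_gramThree_frame_pos hC hfr hgi hpos using 2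
  ext i j
  have hfix : ((p i, (0 : ℚ)) : V × ℚ) = extendById h (p i, 0) := by rw [extendById_apply, hhp]
  simp only [gramThree, Matrix.of_apply, LinearEquiv.mul_apply]
  nth_rewrite 1 [hfix]
  rw [hext]

/-- Assume `L = U ⊕ U ⊕ U` and `d ≥ 3`. Every `g ∈ Γ` acts on the
discriminant group `Λ*/Λ` (a cyclic group of order `2d`) as multiplication by a uniquely
determined sign `ξ(g) ∈ {±1}`; the map `g ↦ det(g)·ξ(g)` is a group homomorphism
`Γ → {±1}`; its kernel `Γ₀` together with the image of `O⁺(L)` in `Γ` generate `Γ`; and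
there is a reflection `ρ_w ∈ O⁺(L)` in a class `w ∈ L` with `(w,w) = −2` on which `det·ξ`
takes the value `−1`. -/
theorem statement13
    {V : Type*} [AddCommGroup V] [Module ℚ V] [FiniteDimensional ℚ V]
    (B : BilinForm ℚ V) (L : Submodule ℤ V) (d : ℤ)
    (hsymm : ∀ x y, B x y = B y x)
    (hfull : Submodule.span ℚ (L : Set V) = ⊤)
    (hU3span : ∃ e f : Fin 3 → V, (∀ i, e i ∈ L) ∧ (∀ i, f i ∈ L) ∧
      (∀ i j, B (e i) (e j) = 0) ∧ (∀ i j, B (f i) (f j) = 0) ∧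
      (∀ i j, B (e i) (f j) = if i = j then -1 else 0) ∧
      L = Submodule.span ℤ (Set.range e ∪ Set.range f))
    (hd : 3 ≤ d) :
    -- the discriminant group `Λ*/Λ` is cyclic of order `2d`
    (∃ x₀ ∈ dualLattice (prodForm B d) (L.prod intLat),
      (∀ x ∈ dualLattice (prodForm B d) (L.prod intLat),
        ∃ n : ℤ, x - n • x₀ ∈ L.prod intLat) ∧
      (2 * d) • x₀ ∈ L.prod intLat ∧
      ∀ m : ℤ, 0 < m → m < 2 * d → ¬ m • x₀ ∈ L.prod intLat) ∧
    -- every `g ∈ Γ` acts on `Λ*/Λ` as a uniquely determined sign `ξ(g) ∈ {±1}`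
    (∀ g : (V × ℚ) ≃ₗ[ℚ] (V × ℚ), InGamma (prodForm B d) (L.prod intLat) g →
      ∃! ε : ℤ, (ε = 1 ∨ ε = -1) ∧
        ∀ x ∈ dualLattice (prodForm B d) (L.prod intLat),
          g x - (ε : ℚ) • x ∈ L.prod intLat) ∧
    -- `g ↦ det(g)·ξ(g)` takes values in `{±1}` ...
    (∀ g : (V × ℚ) ≃ₗ[ℚ] (V × ℚ), InGamma (prodForm B d) (L.prod intLat) g →
      ∀ ε : ℤ, (ε = 1 ∨ ε = -1) →
        (∀ x ∈ dualLattice (prodForm B d) (L.prod intLat),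
          g x - (ε : ℚ) • x ∈ L.prod intLat) →
        LinearMap.det (g : (V × ℚ) →ₗ[ℚ] (V × ℚ)) * (ε : ℚ) = 1 ∨
          LinearMap.det (g : (V × ℚ) →ₗ[ℚ] (V × ℚ)) * (ε : ℚ) = -1) ∧
    -- ... and is a group homomorphism: `ξ` is multiplicative (`det` is automatically so)
    (∀ g₁ g₂ : (V × ℚ) ≃ₗ[ℚ] (V × ℚ),
      InGamma (prodForm B d) (L.prod intLat) g₁ →
      InGamma (prodForm B d) (L.prod intLat) g₂ →
      ∀ ε₁ ε₂ : ℤ, (ε₁ = 1 ∨ ε₁ = -1) → (ε₂ = 1 ∨ ε₂ = -1) →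
        (∀ x ∈ dualLattice (prodForm B d) (L.prod intLat),
          g₁ x - (ε₁ : ℚ) • x ∈ L.prod intLat) →
        (∀ x ∈ dualLattice (prodForm B d) (L.prod intLat),
          g₂ x - (ε₂ : ℚ) • x ∈ L.prod intLat) →
        ∀ x ∈ dualLattice (prodForm B d) (L.prod intLat),
          (g₁ * g₂) x - ((ε₁ * ε₂ : ℤ) : ℚ) • x ∈ L.prod intLat) ∧
    -- the kernel `Γ₀` of `det·ξ` together with the image of `O⁺(L)` generate `Γ`
    ({g : (V × ℚ) ≃ₗ[ℚ] (V × ℚ) | InGamma (prodForm B d) (L.prod intLat) g} ⊆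
      ↑(Subgroup.closure
        ({g : (V × ℚ) ≃ₗ[ℚ] (V × ℚ) | InGamma (prodForm B d) (L.prod intLat) g ∧
            ∀ ε : ℤ, (ε = 1 ∨ ε = -1) →
              (∀ x ∈ dualLattice (prodForm B d) (L.prod intLat),
                g x - (ε : ℚ) • x ∈ L.prod intLat) →
              LinearMap.det (g : (V × ℚ) →ₗ[ℚ] (V × ℚ)) * (ε : ℚ) = 1} ∪
         {ghat : (V × ℚ) ≃ₗ[ℚ] (V × ℚ) | ∃ g : V ≃ₗ[ℚ] V, g ∈ isomGroup B ∧
            PreservesLattice L g ∧ OrientPos B g ∧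
            ∀ p : V × ℚ, ghat p = (g p.1, p.2)}))) ∧
    -- existence of a reflection `ρ_w ∈ O⁺(L)`, `w ∈ L`, `(w,w) = −2`, with `det·ξ = −1`
    ∃ w ∈ L, B w w = -2 ∧
      ∃ g : V ≃ₗ[ℚ] V, (∀ x, g x = x - (2 * B w x / B w w) • w) ∧
        g ∈ isomGroup B ∧ PreservesLattice L g ∧ OrientPos B g ∧
        ∀ ghat : (V × ℚ) ≃ₗ[ℚ] (V × ℚ), (∀ p : V × ℚ, ghat p = (g p.1, p.2)) →
          ∀ ε : ℤ, (ε = 1 ∨ ε = -1) →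
            (∀ x ∈ dualLattice (prodForm B d) (L.prod intLat),
              ghat x - (ε : ℚ) • x ∈ L.prod intLat) →
            LinearMap.det (ghat : (V × ℚ) →ₗ[ℚ] (V × ℚ)) * (ε : ℚ) = -1 := by
  obtain ⟨e, f, -, -, hee, hff, hef, hLe⟩ := hU3span
  have H : IsHyperbolicBasis B L e f := ⟨hsymm, hee, hff, hef, hLe, hfull⟩
  have hL := H.dualLattice_eq
  have hd0 : 0 < d := by omega
  have hd1 : 1 < d := by omega
  have hp := H.isMaximalPosFrame
  have hwL : e 0 + f 0 ∈ L := add_mem (H.left_mem 0) (H.right_mem 0)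
  have hw : B (e 0 + f 0) (e 0 + f 0) = -2 := by
    simp only [map_add, LinearMap.add_apply, hee, hff, hef, H.right_left, if_true]
    norm_num
  set r := negTwoReflection B (e 0 + f 0) hw with hr
  have hri : r ∈ isomGroup B := negTwoReflection_mem_isomGroup hw hsymm
  have hrL : PreservesLattice L r := negTwoReflection_preservesLattice hw hL hwL
  have hrp : ∀ i, r (e i - f i) = e i - f i := fun i => by
    rw [hr, negTwoReflection_apply]
    simp only [map_add, map_sub, LinearMap.add_apply, hee, hff, hef, H.right_left]
    simp
  have hro : OrientPos B r := hp.orientPos hsymm (by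
    simp only [hrp]
    exact hp.isPosTriple.det_gramThree_self_pos)
  have hrdet : LinearMap.det (extendById r : (V × ℚ) →ₗ[ℚ] (V × ℚ)) = -1 := by
    rw [det_extendById, hr, det_negTwoReflection]
  have hrξ := extendById_sub_mem hL hrL (d := d)
  have hdet : ∀ g : (V × ℚ) ≃ₗ[ℚ] (V × ℚ), InGamma (prodForm B d) (L.prod intLat) g →
      ∀ ε : ℤ, (ε = 1 ∨ ε = -1) →
        LinearMap.det (g : (V × ℚ) →ₗ[ℚ] (V × ℚ)) * (ε : ℚ) = 1 ∨
          LinearMap.det (g : (V × ℚ) →ₗ[ℚ] (V × ℚ)) * (ε : ℚ) = -1 := by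
    intro g hg ε hε
    have h := sq_eq_one_iff.1 (det_sq_eq_one_of_mem_isomGroup (prodForm_comm hsymm d)
      (prodForm_separating H.separating hd0.ne') hg.1)
    rcases h with h | h <;> rcases hε with rfl | rfl <;> simp [h]
  refine ⟨⟨_, discriminant_generator_mem hL hd0, ?_, ?_, ?_⟩, ?_, fun g hg ε hε _ => hdet g hg ε hε,
    ?_, ?_, _, hwL, hw, r, ?_, hri, hrL, hro, ?_⟩
  · intro x hx
    obtain ⟨h1, n, hn⟩ := (mem_dualLattice_prodForm hL).1 hx
    refine ⟨n, by simpa using h1, mem_intLat.2 ⟨0, ?_⟩⟩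
    simp only [Prod.snd_sub, Prod.smul_snd, zsmul_eq_mul, ← hn]
    field_simp
    simp
  · exact (zsmul_discriminant_generator_mem_iff L hd0).2 dvd_rfl
  · intro m hm hmd h
    have := Int.le_of_dvd hm ((zsmul_discriminant_generator_mem_iff L hd0).1 h)
    omega
  · intro g hg
    obtain ⟨ε, hε, hgε⟩ := hg.2.2.2.exists_sign
    exact ⟨ε, ⟨hε, hgε⟩, fun η hη => discriminant_sign_unique hL hd1 hη.1 hε hη.2 hgε⟩
  · intro g₁ g₂ hg₁ _ ε₁ ε₂ _ _ h₁ h₂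
    exact mul_sub_smul_mem hg₁.2.1.1 h₁ h₂
  · intro g hg
    rw [SetLike.mem_coe]
    obtain ⟨ε, hε, hgε⟩ := hg.2.2.2.exists_sign
    rcases hdet g hg ε hε with h | h
    · refine Subgroup.subset_closure (Or.inl ⟨hg, fun η hη hgη => ?_⟩)
      rwa [discriminant_sign_unique hL hd1 hη hε hgη hgε]
    · have hmul := hg.extendById_mul hsymm hL hd0.le hp hri hrL hrp
      have hmulξ := mul_sub_smul_mem hrL.extendById.1 hrξ hgε
      refine (Subgroup.mul_mem_cancel_left _ (x := extendById r) ?_).1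
        (Subgroup.subset_closure (Or.inl ⟨hmul, fun η hη hgη => ?_⟩))
      · exact Subgroup.subset_closure (Or.inr ⟨r, hri, hrL, hro, extendById_apply r⟩)
      rw [discriminant_sign_unique hL hd1 hη (by simpa using hε) hgη hmulξ]
      have hcoe : ((extendById r * g : (V × ℚ) ≃ₗ[ℚ] (V × ℚ)) : (V × ℚ) →ₗ[ℚ] (V × ℚ))
          = (extendById r : (V × ℚ) →ₗ[ℚ] (V × ℚ)) * (g : (V × ℚ) →ₗ[ℚ] (V × ℚ)) := rfl
      rw [hcoe, map_mul, hrdet]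
      push_cast
      linarith
  · intro x
    rw [hr, negTwoReflection_apply, hw,
      show 2 * B (e 0 + f 0) x / -2 = -(B (e 0 + f 0) x) by ring, neg_smul, sub_neg_eq_add]
  · intro ghat hghat ε hε hgε
    have he : ghat = extendById r := LinearEquiv.ext hghat
    subst he
    rw [discriminant_sign_unique hL hd1 hε (Or.inl rfl) hgε hrξ, hrdet]
    norm_num
end
end
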